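/- arXiv:1405.3211 — 10 statements merged into one kernel-verified Lean document; each statement's English description precedes it below -/
import Mathlib

section
/- For any natural numbers M_A ≥ M_B ≥ 2 and any r with 2^r < M_B, the correlation p̂ is no-signaling but is NOT achievable by local shared randomness plus r bits of bi-directional classical communication; consequently, simulating all no-signaling correlations with M_A and M_B measurement settings requires at least ⌈log₂ M_B⌉ bits of classical communication. -/
/-- A deterministic bi-directional `r`-bit strategy: Alice sends `s` bits (`κ`),
Bob sends `r - s` bits (`σ`), and each party outputs a deterministic function of
their own input and the received message. -/
structure BiStrategy (MA MB r : ℕ) where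
  s : ℕ
  hs : s ≤ r
  kappa : Fin MA → Fin (2 ^ s)
  sigma : Fin MB → Fin (2 ^ (r - s))
  f : Fin MA × Fin (2 ^ (r - s)) → Fin 2
  g : Fin MB × Fin (2 ^ s) → Fin 2

/-- The correlation generated by a deterministic bi-directional strategy. -/
def BiStrategy.corr {MA MB r : ℕ} (S : BiStrategy MA MB r)
    (a b : Fin 2) (i : Fin MA) (j : Fin MB) : ℝ :=
  if a = S.f (i, S.sigma j) ∧ b = S.g (j, S.kappa i) then 1 else 0

/-- A correlation is achievable by local shared randomness plus `r` bits of
bi-directional classical communication if it is a convex combination of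
correlations of deterministic bi-directional `r`-bit strategies. -/
def AchievableBi (MA MB r : ℕ) (p : Fin 2 → Fin 2 → Fin MA → Fin MB → ℝ) : Prop :=
  ∃ (n : ℕ) (w : Fin n → ℝ) (S : Fin n → BiStrategy MA MB r),
    (∀ k, 0 ≤ w k) ∧ (∑ k, w k = 1) ∧
    ∀ a b i j, p a b i j = ∑ k, w k * (S k).corr a b i j

/-- The no-signaling correlation `p̂` of Bacon–Toner / Jones–Masanes:
for `i = 0` perfectly correlated; for `1 ≤ i ≤ M_B - 1` perfectly correlated
when `j ≠ i` and perfectly anti-correlated when `j = i`; for `i ≥ M_B`,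
Alice deterministically outputs `0` with Bob uniform. -/
noncomputable def phat (MA MB : ℕ) (a b : Fin 2) (i : Fin MA) (j : Fin MB) : ℝ :=
  if (i : ℕ) = 0 ∨ ((i : ℕ) < MB ∧ (j : ℕ) ≠ (i : ℕ)) then
    (if a = b then 1 / 2 else 0)
  else if (i : ℕ) < MB then
    (if a ≠ b then 1 / 2 else 0)
  else
    (if a = 0 then 1 / 2 else 0)

theorem phat_key {n : ℕ} {K L : Type*} [Fintype K] [Fintype L] (z : Fin n)
    (hz : ∀ i, z ≤ i)
    (ka : Fin n → K) (si : Fin n → L) (f : Fin n → L → Bool) (g : Fin n → K → Bool)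
    (H : ∀ i j, f i (si j) = (g j (ka i)).xor (decide (i = j ∧ i ≠ z))) :
    n ≤ Fintype.card K * Fintype.card L := by
  classical
  -- a pair sharing both messages forms a complete class of `ka`
  have cls : ∀ i i' k, i' < i → ka i' = ka i → si i' = si i → ka k = ka i → k = i ∨ k = i' := by
    intro i i' k hlt h1 h2 h3
    have hi : i ≠ z := fun h => absurd (hz i') (by rw [← h]; exact not_le.mpr hlt)
    have hne : i ≠ i' := hlt.ne'
    by_contra hk
    push Not at hk
    have e1 := H k i
    have e2 := H k i'
    have e3 := H i i
    have e4 := H i i'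
    rw [h2] at e2 e4
    rw [h3] at e1 e2
    simp only [hk.1, hk.2, hi, hne, false_and, decide_false, Bool.xor_false, ne_eq,
      not_false_eq_true, and_self, decide_true, Bool.xor_true] at e1 e2 e3 e4
    rw [← e1, ← e2] at *
    grind
  have sg : ∀ i i', i' < i → ka i' = ka i → si i' = si i → si z ≠ si i := by
    intro i i' hlt h1 h2 h3
    have hi : i ≠ z := fun h => absurd (hz i') (by rw [← h]; exact not_le.mpr hlt)
    have hne : i ≠ i' := hlt.ne'
    have e1 := H i z
    have e2 := H i i
    have e3 := H i' z
    have e4 := H i' i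
    rw [h3] at e1 e3
    rw [h1] at e3 e4
    simp only [hi, hne.symm, false_and, decide_false, Bool.xor_false, ne_eq,
      not_false_eq_true, and_self, decide_true, Bool.xor_true] at e1 e2 e3 e4
    by_cases hz' : i' = z
    · simp [hz'] at e3
      grind
    · simp [hz'] at e3
      grind
  let D : Fin n → Prop := fun i => ∃ i', i' < i ∧ ka i' = ka i ∧ si i' = si i
  let φ : Fin n → K × L := fun i => if D i then (ka i, si z) else (ka i, si i)
  have mixed : ∀ i j, D i → ¬ D j → ka i = ka j → si z = si j → False := by
    rintro i j ⟨i', hlt, h1, h2⟩ _ h3 h4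
    rcases cls i i' j hlt h1 h2 h3.symm with h | h
    · exact sg i i' hlt h1 h2 (h ▸ h4)
    · exact sg i i' hlt h1 h2 (by rw [h4, h, h2])
  have inj : Function.Injective φ := by
    intro i j hij
    simp only [φ] at hij
    split_ifs at hij with hi hj hj
    · simp only [Prod.mk.injEq, and_true] at hij
      obtain ⟨i', a1, a2, a3⟩ := hi
      obtain ⟨j', b1, b2, b3⟩ := hj
      rcases cls i i' j a1 a2 a3 hij.symm with h | h
      · exact h.symm
      · rcases cls j j' i b1 b2 b3 hij with h' | h'
        · exact h'
        · subst h; subst h'; exact absurd a1 (lt_asymm b1)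
    · simp only [Prod.mk.injEq] at hij
      exact (mixed i j hi hj hij.1 hij.2).elim
    · simp only [Prod.mk.injEq] at hij
      exact (mixed j i hj hi hij.1.symm hij.2.symm).elim
    · simp only [Prod.mk.injEq] at hij
      rcases lt_trichotomy i j with h | h | h
      · exact (hj ⟨i, h, hij.1, hij.2⟩).elim
      · exact h
      · exact (hi ⟨j, h, hij.1.symm, hij.2.symm⟩).elim
  have := Fintype.card_le_of_injective φ inj
  simpa using this


/-- For `M_A ≥ M_B ≥ 2` and `2^r < M_B`, the correlation `p̂` is a valid
no-signaling correlation that is not achievable by local shared randomness plus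
`r` bits of bi-directional classical communication; hence at least
`⌈log₂ M_B⌉` bits of classical communication are required to simulate all
no-signaling correlations. -/
theorem phat_noSignaling_not_achievable (MA MB r : ℕ) (hBA : MB ≤ MA) (hB : 2 ≤ MB)
    (hr : 2 ^ r < MB) :
    (∀ a b i j, 0 ≤ phat MA MB a b i j) ∧
    (∀ i j, ∑ a : Fin 2, ∑ b : Fin 2, phat MA MB a b i j = 1) ∧
    (∀ (a : Fin 2) (i : Fin MA) (j j' : Fin MB),
      ∑ b : Fin 2, phat MA MB a b i j = ∑ b : Fin 2, phat MA MB a b i j') ∧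
    (∀ (b : Fin 2) (j : Fin MB) (i i' : Fin MA),
      ∑ a : Fin 2, phat MA MB a b i j = ∑ a : Fin 2, phat MA MB a b i' j) ∧
    ¬ AchievableBi MA MB r (phat MA MB) := by
  refine ⟨?_, ?_, ?_, ?_, ?_⟩
  · intro a b i j
    unfold phat
    split_ifs <;> norm_num
  · intro i j
    simp only [phat, Fin.sum_univ_two]
    norm_num
    split_ifs <;> first | omega | norm_num
  · intro a i j j'
    have h2 : a = 0 ∨ a = 1 := by omega
    simp only [phat, Fin.sum_univ_two]
    rcases h2 with rfl | rfl <;> simp <;> split_ifs <;> first | omega | norm_num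
  · intro b j i i'
    have h2 : b = 0 ∨ b = 1 := by omega
    simp only [phat, Fin.sum_univ_two]
    rcases h2 with rfl | rfl <;> simp <;> split_ifs <;> first | omega | norm_num
  · rintro ⟨n, w, S, hw, hsum, hp⟩
    obtain ⟨k, hk⟩ : ∃ k, 0 < w k := by
      by_contra hcon
      push Not at hcon
      have : ∑ k, w k ≤ 0 := Finset.sum_nonpos fun k _ => hcon k
      linarith
    have hpos : ∀ i j, 0 < phat MA MB ((S k).f (i, (S k).sigma j)) ((S k).g (j, (S k).kappa i)) i j := by
      intro i j
      rw [hp]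
      refine lt_of_lt_of_le ?_ (Finset.single_le_sum (f := fun k' => w k' * (S k').corr ((S k).f (i, (S k).sigma j)) ((S k).g (j, (S k).kappa i)) i j) ?_ (Finset.mem_univ k))
      · simpa [BiStrategy.corr] using hk
      · intro k' _
        refine mul_nonneg (hw k') ?_
        unfold BiStrategy.corr
        split_ifs <;> norm_num
    have key := phat_key (n := MB) ⟨0, by omega⟩ (fun i => Nat.zero_le _)
      (fun i => (S k).kappa (Fin.castLE hBA i)) (S k).sigma
      (fun i c => decide ((S k).f (Fin.castLE hBA i, c) = 1))
      (fun j d => decide ((S k).g (j, d) = 1)) (by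
        intro i j
        have h := hpos (Fin.castLE hBA i) j
        generalize (S k).f (Fin.castLE hBA i, (S k).sigma j) = a at *
        generalize (S k).g (j, (S k).kappa (Fin.castLE hBA i)) = b at *
        have ha : a = 0 ∨ a = 1 := by omega
        have hb : b = 0 ∨ b = 1 := by omega
        have hi := i.isLt
        simp only [phat, Fin.val_castLE] at h
        rcases ha with rfl | rfl <;> rcases hb with rfl | rfl <;>
          simp [Fin.ext_iff] at h ⊢ <;> split_ifs at h <;> first | omega | simp_all | skip)
    rw [Fintype.card_fin, Fintype.card_fin, ← pow_add, Nat.add_sub_cancel' (S k).hs] at key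
    omega
end

section
/- Let M_B ≥ 3 and let r, s be natural numbers with s ≤ r and 2^r < M_B. Then for any functions κ : Fin M_B → Fin 2^s and σ : Fin M_B → Fin 2^(r−s), there exist three pairwise distinct values t₀, t₁, t₂ ∈ Fin M_B such that κ(t₀) = κ(t₂) and σ(t₁) = σ(t₂). -/
theorem three_collision_aux {T A B : Type*} [DecidableEq T] [DecidableEq A] [DecidableEq B]
    (f : T → A) (g : T → B) (n : ℕ) : ∀ S : Finset T, S.card = n → 3 ≤ S.card →
    (S.image f).card * (S.image g).card < S.card →
    ∃ t₀ t₁ t₂ : T, t₀ ≠ t₁ ∧ t₀ ≠ t₂ ∧ t₁ ≠ t₂ ∧ f t₀ = f t₂ ∧ g t₁ = g t₂ := by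
  induction n using Nat.strong_induction_on with
  | _ n ih =>
    intro S hn h3 hlt
    rw [← Finset.card_product] at hlt
    obtain ⟨x, hx, y, hy, hxy, he⟩ := Finset.exists_ne_map_eq_of_card_lt_of_maps_to
      (f := fun t => (f t, g t)) hlt (by
        intro t ht
        have ht' : t ∈ S := ht
        simpa using ⟨⟨t, ht', rfl⟩, ⟨t, ht', rfl⟩⟩)
    obtain ⟨hf, hg⟩ := Prod.mk.inj he
    rw [Finset.card_product] at hlt
    by_contra hcon
    have key : ∀ z, z ≠ x → z ≠ y → f z ≠ f x ∧ g z ≠ g x := by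
      intro z hzx hzy
      refine ⟨fun h => hcon ⟨z, y, x, hzy, hzx, hxy.symm, h, hg.symm⟩,
        fun h => hcon ⟨y, z, x, hzy.symm, hxy.symm, hzx, hf.symm, h⟩⟩
    have hc : ((S.erase x).erase y).card = S.card - 2 := by
      rw [Finset.card_erase_of_mem (by simp [hy, hxy.symm]), Finset.card_erase_of_mem hx]
      omega
    set S' := (S.erase x).erase y with hS'
    have hmem : ∀ z ∈ S', z ≠ x ∧ z ≠ y ∧ z ∈ S := by
      intro z hz
      simp only [hS', Finset.mem_erase] at hz
      tauto
    have hfc : (S'.image f).card ≤ (S.image f).card - 1 := by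
      rw [← Finset.card_erase_of_mem (Finset.mem_image_of_mem f hx)]
      apply Finset.card_le_card
      intro a ha
      obtain ⟨z, hz, rfl⟩ := Finset.mem_image.1 ha
      obtain ⟨h1, h2, h4⟩ := hmem z hz
      exact Finset.mem_erase.2 ⟨(key z h1 h2).1, Finset.mem_image_of_mem f h4⟩
    have hgc : (S'.image g).card ≤ (S.image g).card - 1 := by
      rw [← Finset.card_erase_of_mem (Finset.mem_image_of_mem g hx)]
      apply Finset.card_le_card
      intro a ha
      obtain ⟨z, hz, rfl⟩ := Finset.mem_image.1 ha
      obtain ⟨h1, h2, h4⟩ := hmem z hz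
      exact Finset.mem_erase.2 ⟨(key z h1 h2).2, Finset.mem_image_of_mem g h4⟩
    have hne : S'.Nonempty := Finset.card_pos.1 (by omega)
    have hfp : 0 < (S'.image f).card := Finset.card_pos.2 (hne.image f)
    have hgp : 0 < (S'.image g).card := Finset.card_pos.2 (hne.image g)
    have hm := Nat.mul_le_mul hfc hgc
    obtain ⟨a, ha⟩ : ∃ a, (S.image f).card = a + 2 := ⟨(S.image f).card - 2, by omega⟩
    obtain ⟨b, hb⟩ : ∃ b, (S.image g).card = b + 2 := ⟨(S.image g).card - 2, by omega⟩
    rw [ha, hb] at hlt hm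
    have e1 : a + 2 - 1 = a + 1 := rfl
    have e2 : b + 2 - 1 = b + 1 := rfl
    rw [e1, e2] at hm
    have hab : 0 ≤ a * b := Nat.zero_le _
    ring_nf at hlt hm
    refine hcon (ih (S.card - 2) (by omega) S' hc (by omega) ?_)
    rw [hc]
    have := Nat.lt_sub_iff_add_lt.2 (show 1 + a + a * b + b + 2 < S.card by omega)
    exact lt_of_le_of_lt hm (by omega)


/-- If `M_B ≥ 3`, `s ≤ r` and `2^r < M_B`, then for any message-encoding
functions `κ : Fin M_B → Fin 2^s` and `σ : Fin M_B → Fin 2^(r-s)` there exist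
three pairwise distinct inputs `t₀, t₁, t₂` with `κ t₀ = κ t₂` and
`σ t₁ = σ t₂`. -/
theorem exists_three_collision (MB r s : ℕ) (hMB : 3 ≤ MB) (hs : s ≤ r)
    (hr : 2 ^ r < MB)
    (κ : Fin MB → Fin (2 ^ s)) (σ : Fin MB → Fin (2 ^ (r - s))) :
    ∃ t₀ t₁ t₂ : Fin MB, t₀ ≠ t₁ ∧ t₀ ≠ t₂ ∧ t₁ ≠ t₂ ∧
      κ t₀ = κ t₂ ∧ σ t₁ = σ t₂ := by

  refine three_collision_aux κ σ MB Finset.univ (by simp) (by simpa using hMB) ?_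
  have h1 : (Finset.univ.image κ).card ≤ 2 ^ s := by
    simpa using Finset.card_le_univ (Finset.univ.image κ)
  have h2 : (Finset.univ.image σ).card ≤ 2 ^ (r - s) := by
    simpa using Finset.card_le_univ (Finset.univ.image σ)
  calc _ ≤ 2 ^ s * 2 ^ (r - s) := Nat.mul_le_mul h1 h2
    _ = 2 ^ r := by rw [← pow_add, Nat.add_sub_cancel' hs]
    _ < _ := by simpa using hr
end

section
/- Let M_A ≥ M_B, let t₀, t₁, t₂ be natural numbers less than M_B, let κ : Fin M_A → Fin C_A and σ : Fin M_B → Fin C_B be functions with κ(t₀) = κ(t₂) and σ(t₁) = σ(t₂), and let q_A : Fin 2 → Fin M_A → Fin C_B → ℝ and q_B : Fin 2 → Fin M_B → Fin C_A → ℝ be nonnegative with Σ_{a∈Fin 2} q_A(a|i,c) = 1 and Σ_{b∈Fin 2} q_B(b|j,c') = 1 for all inputs. Define p(ab|ij) := q_A(a|i,σ(j))·q_B(b|j,κ(i)). Then the following eight equalities cannot all hold simultaneously: p(01|t₀t₁) = 0, p(10|t₀t₁) = 0, p(01|t₀t₂) = 0, p(10|t₀t₂) = 0, p(01|t₂t₁)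 = 0, p(10|t₂t₁) = 0, p(00|t₂t₂) = 0, p(11|t₂t₂) = 0. -/
/-- In a deterministic-communication round where Alice sends `κ(i)` and Bob
sends `σ(j)`, and each party samples a binary output from a local conditional
distribution, if `κ t₀ = κ t₂` and `σ t₁ = σ t₂` for three inputs
`t₀, t₁, t₂ < M_B`, then the eight vanishing conditions of `p̂` cannot all hold
for the product correlation `p(ab|ij) = q_A(a|i,σ(j)) · q_B(b|j,κ(i))`. -/
theorem product_strategy_contradiction (MA MB CA CB : ℕ) (hBA : MB ≤ MA)
    (t₀ t₁ t₂ : Fin MB)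
    (κ : Fin MA → Fin CA) (σ : Fin MB → Fin CB)
    (hκ : κ (Fin.castLE hBA t₀) = κ (Fin.castLE hBA t₂))
    (hσ : σ t₁ = σ t₂)
    (qA : Fin 2 → Fin MA → Fin CB → ℝ) (qB : Fin 2 → Fin MB → Fin CA → ℝ)
    (hqA0 : ∀ a i c, 0 ≤ qA a i c) (hqB0 : ∀ b j c, 0 ≤ qB b j c)
    (hqA1 : ∀ i c, ∑ a : Fin 2, qA a i c = 1)
    (hqB1 : ∀ j c, ∑ b : Fin 2, qB b j c = 1)
    (p : Fin 2 → Fin 2 → Fin MA → Fin MB → ℝ)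
    (hp : ∀ a b i j, p a b i j = qA a i (σ j) * qB b j (κ i)) :
    ¬ (p 0 1 (Fin.castLE hBA t₀) t₁ = 0 ∧ p 1 0 (Fin.castLE hBA t₀) t₁ = 0 ∧
       p 0 1 (Fin.castLE hBA t₀) t₂ = 0 ∧ p 1 0 (Fin.castLE hBA t₀) t₂ = 0 ∧
       p 0 1 (Fin.castLE hBA t₂) t₁ = 0 ∧ p 1 0 (Fin.castLE hBA t₂) t₁ = 0 ∧
       p 0 0 (Fin.castLE hBA t₂) t₂ = 0 ∧ p 1 1 (Fin.castLE hBA t₂) t₂ = 0) := by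
  rintro ⟨h1, h2, h3, h4, h5, h6, h7, h8⟩
  simp only [hp, hκ, hσ] at h1 h2 h3 h4 h5 h6 h7 h8
  have a0 := hqA1 (Fin.castLE hBA t₀) (σ t₂)
  have a2 := hqA1 (Fin.castLE hBA t₂) (σ t₂)
  have b1 := hqB1 t₁ (κ (Fin.castLE hBA t₂))
  have b2 := hqB1 t₂ (κ (Fin.castLE hBA t₂))
  simp only [Fin.sum_univ_two] at a0 a2 b1 b2
  have key : ∀ x x' y y' : ℝ, x + x' = 1 → y + y' = 1 → x * y' = 0 → x' * y = 0 → x = y := by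
    intro x x' y y' hx hy h h'
    have e1 : x' = 1 - x := by linarith
    have e2 : y' = 1 - y := by linarith
    subst e1 e2
    linarith
  have k1 := key _ _ _ _ a0 b1 h1 h2
  have k2 := key _ _ _ _ a0 b2 h3 h4
  have k3 := key _ _ _ _ a2 b1 h5 h6
  have k4 := k3.trans (k1.symm.trans k2)
  have k5 : qA 1 (Fin.castLE hBA t₂) (σ t₂) = qB 1 t₂ (κ (Fin.castLE hBA t₂)) := by linarith
  rw [k4] at h7 a2
  rw [k5] at h8 a2
  have z7 := mul_self_eq_zero.mp h7
  have z8 := mul_self_eq_zero.mp h8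
  linarith
end

section
/- Every correlation p achievable by local shared randomness plus one bit of communication from Alice to Bob (with M_A = 3, M_B = 2 measurement settings and binary outcomes) satisfies Bell inequality I: −q_A(0|0) − p(00|10) + p(00|20) + p(00|11) − p(10|00) + p(10|20) − p(10|01) ≤ 1. -/
/-- The correlation of a deterministic Alice→Bob one-bit strategy `(κ, f, g)`
for 3×2 measurement settings with binary outcomes. -/
def detCorr (κ : Fin 3 → Fin 2) (f : Fin 3 → Fin 2) (g : Fin 2 × Fin 2 → Fin 2)
    (a b : Fin 2) (i : Fin 3) (j : Fin 2) : ℝ :=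
  if a = f i ∧ b = g (j, κ i) then 1 else 0

/-- A correlation is achievable by local shared randomness plus one bit of
communication from Alice to Bob if it is a convex combination of correlations
of deterministic Alice→Bob one-bit strategies. -/
def AchievableAtoB (p : Fin 2 → Fin 2 → Fin 3 → Fin 2 → ℝ) : Prop :=
  ∃ (n : ℕ) (w : Fin n → ℝ) (κ : Fin n → Fin 3 → Fin 2) (f : Fin n → Fin 3 → Fin 2)
    (g : Fin n → Fin 2 × Fin 2 → Fin 2),
    (∀ k, 0 ≤ w k) ∧ (∑ k, w k = 1) ∧
    ∀ a b i j, p a b i j = ∑ k, w k * detCorr (κ k) (f k) (g k) a b i j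

/-- Alice's marginal probability of outcome 0 on input `i`. -/
def qA0 (p : Fin 2 → Fin 2 → Fin 3 → Fin 2 → ℝ) (i : Fin 3) : ℝ :=
  p 0 0 i 0 + p 0 1 i 0

set_option maxHeartbeats 8000000 in
theorem detCorr_bound (κ f : Fin 3 → Fin 2) (g : Fin 2 × Fin 2 → Fin 2) :
    -(detCorr κ f g 0 0 0 0 + detCorr κ f g 0 1 0 0) - detCorr κ f g 0 0 1 0
      + detCorr κ f g 0 0 2 0 + detCorr κ f g 0 0 1 1 - detCorr κ f g 1 0 0 0
      + detCorr κ f g 1 0 2 0 - detCorr κ f g 1 0 0 1 ≤ 1 := by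
  unfold detCorr
  generalize f 0 = f0
  generalize f 1 = f1
  generalize f 2 = f2
  generalize κ 0 = k0
  generalize κ 1 = k1
  generalize κ 2 = k2
  have h2 : ∀ x : Fin 2, x = 0 ∨ x = 1 := by decide
  rcases h2 k0 with rfl | rfl <;> rcases h2 k1 with rfl | rfl <;>
    rcases h2 k2 with rfl | rfl <;>
    rcases h2 f0 with rfl | rfl <;> rcases h2 f1 with rfl | rfl <;>
    rcases h2 f2 with rfl | rfl <;>
    rcases h2 (g (0, 0)) with h00 | h00 <;> rcases h2 (g (0, 1)) with h01 | h01 <;>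
    rcases h2 (g (1, 0)) with h10 | h10 <;> rcases h2 (g (1, 1)) with h11 | h11 <;>
    norm_num [h00, h01, h10, h11]

/-- Bell inequality I for LSR plus one bit of Alice→Bob communication. -/
theorem bell_I (p : Fin 2 → Fin 2 → Fin 3 → Fin 2 → ℝ) (h : AchievableAtoB p) :
    -qA0 p 0 - p 0 0 1 0 + p 0 0 2 0 + p 0 0 1 1 - p 1 0 0 0 + p 1 0 2 0 - p 1 0 0 1 ≤ 1 := by
  obtain ⟨n, w, κ, f, g, hw, hs, hp⟩ := h
  have key := Finset.sum_le_sum (s := Finset.univ) fun k _ =>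
    mul_le_mul_of_nonneg_left (detCorr_bound (κ k) (f k) (g k)) (hw k)
  simp only [mul_one, hs] at key
  refine le_trans (le_of_eq ?_) key
  simp only [qA0, hp, mul_add, mul_sub, mul_neg, Finset.sum_add_distrib, Finset.sum_sub_distrib,
    Finset.sum_neg_distrib]
end

section
/- Every correlation p achievable by local shared randomness plus one bit of communication from Alice to Bob (with M_A = 3, M_B = 2 measurement settings and binary outcomes) satisfies Bell inequality II: −p(00|00) − p(00|10) + p(00|20) − p(00|01) + p(00|11) − p(10|00) + p(10|20) − p(10|01) ≤ 1. -/
/-- The inequality for deterministic strategies. -/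
theorem bell_II_det (κ f : Fin 3 → Fin 2) (g : Fin 2 × Fin 2 → Fin 2) :
    -detCorr κ f g 0 0 0 0 - detCorr κ f g 0 0 1 0 + detCorr κ f g 0 0 2 0
      - detCorr κ f g 0 0 0 1 + detCorr κ f g 0 0 1 1 - detCorr κ f g 1 0 0 0
      + detCorr κ f g 1 0 2 0 - detCorr κ f g 1 0 0 1 ≤ 1 := by
  have two : ∀ x : Fin 2, x = 0 ∨ x = 1 := by decide
  unfold detCorr
  generalize κ 0 = k0
  generalize κ 1 = k1
  generalize κ 2 = k2
  generalize f 0 = f0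
  generalize f 1 = f1
  generalize f 2 = f2
  rcases two k0 with rfl | rfl <;> rcases two k1 with rfl | rfl <;>
    rcases two k2 with rfl | rfl <;>
    generalize g (0, 0) = g00 <;> generalize g (0, 1) = g01 <;>
    generalize g (1, 0) = g10 <;> generalize g (1, 1) = g11 <;>
    rcases two f0 with rfl | rfl <;> rcases two f1 with rfl | rfl <;>
    rcases two f2 with rfl | rfl <;> simp <;> split_ifs <;> norm_num <;> simp_all

/-- Bell inequality II for LSR plus one bit of Alice→Bob communication. -/
theorem bell_II (p : Fin 2 → Fin 2 → Fin 3 → Fin 2 → ℝ) (h : AchievableAtoB p) :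
    -p 0 0 0 0 - p 0 0 1 0 + p 0 0 2 0 - p 0 0 0 1 + p 0 0 1 1 - p 1 0 0 0 + p 1 0 2 0 - p 1 0 0 1 ≤ 1 := by
  obtain ⟨n, w, κ, f, g, hw, hs, hp⟩ := h
  have key := Finset.sum_le_sum (s := Finset.univ) (fun k _ =>
    mul_le_mul_of_nonneg_left (bell_II_det (κ k) (f k) (g k)) (hw k))
  simp only [mul_one, hs, mul_add, mul_sub, mul_neg, Finset.sum_add_distrib,
    Finset.sum_sub_distrib, Finset.sum_neg_distrib, ← hp] at key
  exact key
end

section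
/- Every correlation p achievable by local shared randomness plus one bit of communication from Alice to Bob (with M_A = 3, M_B = 2 measurement settings and binary outcomes) satisfies Bell inequality III: −q_A(0|0) − q_A(0|1) + p(00|10) − p(00|20) + p(00|11) + p(00|21) − p(10|00) + p(10|20) − p(10|01) − p(10|21) ≤ 1. -/
/-- Integer-valued indicator used for the finite check. -/
def detInt (x y a b : Fin 2) : ℤ := if a = x ∧ b = y then 1 else 0

theorem detCorr_eq_detInt (κ : Fin 3 → Fin 2) (f : Fin 3 → Fin 2) (g : Fin 2 × Fin 2 → Fin 2)
    (a b : Fin 2) (i : Fin 3) (j : Fin 2) :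
    detCorr κ f g a b i j = (detInt (f i) (g (j, κ i)) a b : ℝ) := by
  unfold detCorr detInt
  split_ifs <;> simp

/-- The best contribution of each of Alice's inputs, given Bob's pair of answers `(y, z)`. -/
theorem bound_zero (x y z : Fin 2) :
    -(detInt x y 0 0 + detInt x y 0 1) - detInt x y 1 0 - detInt x z 1 0
      ≤ (if y = 1 ∧ z = 1 then 0 else -1) := by
  revert x y z; decide

theorem bound_one (x y z : Fin 2) :
    -(detInt x y 0 0 + detInt x y 0 1) + detInt x y 0 0 + detInt x z 0 0
      ≤ (if y = 0 ∧ z = 0 then 1 else 0) := by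
  revert x y z; decide

theorem bound_two (x y z : Fin 2) :
    -detInt x y 0 0 + detInt x z 0 0 + detInt x y 1 0 - detInt x z 1 0
      ≤ (if y = z then 0 else 1) := by
  revert x y z; decide

/-- Bob has only two answer pairs, so the three optima cannot all be reached. -/
theorem bound_sum (G H : Fin 2 → Fin 2) (k l m : Fin 2) :
    (if G k = 1 ∧ H k = 1 then (0 : ℤ) else -1) + (if G l = 0 ∧ H l = 0 then 1 else 0)
      + (if G m = H m then 0 else 1) ≤ 1 := by
  have e : ∀ k : Fin 2, k = 0 ∨ k = 1 := by decide
  rcases e k with rfl | rfl <;> rcases e l with rfl | rfl <;> rcases e m with rfl | rfl <;>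
    split_ifs <;> simp_all

theorem bell_det (κ : Fin 3 → Fin 2) (f : Fin 3 → Fin 2) (g : Fin 2 × Fin 2 → Fin 2) :
    -qA0 (detCorr κ f g) 0 - qA0 (detCorr κ f g) 1 + detCorr κ f g 0 0 1 0
      - detCorr κ f g 0 0 2 0 + detCorr κ f g 0 0 1 1 + detCorr κ f g 0 0 2 1
      - detCorr κ f g 1 0 0 0 + detCorr κ f g 1 0 2 0 - detCorr κ f g 1 0 0 1
      - detCorr κ f g 1 0 2 1 ≤ 1 := by
  simp only [qA0, detCorr_eq_detInt]
  have h0 := bound_zero (f 0) (g (0, κ 0)) (g (1, κ 0))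
  have h1 := bound_one (f 1) (g (0, κ 1)) (g (1, κ 1))
  have h2 := bound_two (f 2) (g (0, κ 2)) (g (1, κ 2))
  have h3 := bound_sum (fun t => g (0, t)) (fun t => g (1, t)) (κ 0) (κ 1) (κ 2)
  have h4 := (add_le_add (add_le_add h0 h1) h2).trans h3
  have h5 := (Int.cast_le (R := ℝ)).mpr h4
  push_cast at h5
  linarith

/-- Bell inequality III for LSR plus one bit of Alice→Bob communication. -/
theorem bell_III (p : Fin 2 → Fin 2 → Fin 3 → Fin 2 → ℝ) (h : AchievableAtoB p) :
    -qA0 p 0 - qA0 p 1 + p 0 0 1 0 - p 0 0 2 0 + p 0 0 1 1 + p 0 0 2 1 - p 1 0 0 0 + p 1 0 2 0 - p 1 0 0 1 - p 1 0 2 1 ≤ 1 := by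
  obtain ⟨n, w, κ, f, g, hw, hs, hp⟩ := h
  have key := Finset.sum_le_sum (s := Finset.univ)
    (fun k _ => mul_le_mul_of_nonneg_left (bell_det (κ k) (f k) (g k)) (hw k))
  simp only [qA0, mul_one, hs, mul_add, mul_sub, mul_neg, Finset.sum_add_distrib,
    Finset.sum_sub_distrib, Finset.sum_neg_distrib] at key
  simp only [qA0, hp]
  linarith
end

section
/- Every correlation p achievable by local shared randomness plus one bit of communication from Alice to Bob (with M_A = 3, M_B = 2 measurement settings and binary outcomes) satisfies Bell inequality IV: −p(00|00) − p(00|10) + p(00|20) − p(00|01) + p(00|11) − p(10|00) − p(10|10) + p(10|20) − p(10|01) + p(10|11) ≤ 1. -/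
/-- Summing over Alice's outcome leaves the indicator of Bob's outcome. -/
lemma detCorr_sum_a (κ f : Fin 3 → Fin 2) (g : Fin 2 × Fin 2 → Fin 2) (i : Fin 3) (j : Fin 2) :
    detCorr κ f g 0 0 i j + detCorr κ f g 1 0 i j = if g (j, κ i) = 0 then 1 else 0 := by
  unfold detCorr
  generalize f i = x
  generalize g (j, κ i) = y
  fin_cases x <;> fin_cases y <;> simp

/-- The inequality for a deterministic strategy: two of the three messages coincide. -/
lemma det_bound (κ f : Fin 3 → Fin 2) (g : Fin 2 × Fin 2 → Fin 2) :
    -detCorr κ f g 0 0 0 0 - detCorr κ f g 0 0 1 0 + detCorr κ f g 0 0 2 0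
      - detCorr κ f g 0 0 0 1 + detCorr κ f g 0 0 1 1 - detCorr κ f g 1 0 0 0
      - detCorr κ f g 1 0 1 0 + detCorr κ f g 1 0 2 0 - detCorr κ f g 1 0 0 1
      + detCorr κ f g 1 0 1 1 ≤ 1 := by
  have h00 := detCorr_sum_a κ f g 0 0
  have h10 := detCorr_sum_a κ f g 1 0
  have h20 := detCorr_sum_a κ f g 2 0
  have h01 := detCorr_sum_a κ f g 0 1
  have h11 := detCorr_sum_a κ f g 1 1
  have hk : κ 2 = κ 0 ∨ κ 2 = κ 1 ∨ κ 0 = κ 1 := by omega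
  rcases hk with hk | hk | hk <;> simp only [hk] at h00 h10 h20 h01 h11 <;> split_ifs at h00 h10 h20 h01 h11 <;> linarith

/-- Bell inequality IV for LSR plus one bit of Alice→Bob communication. -/
theorem bell_IV (p : Fin 2 → Fin 2 → Fin 3 → Fin 2 → ℝ) (h : AchievableAtoB p) :
    -p 0 0 0 0 - p 0 0 1 0 + p 0 0 2 0 - p 0 0 0 1 + p 0 0 1 1 - p 1 0 0 0 - p 1 0 1 0 + p 1 0 2 0 - p 1 0 0 1 + p 1 0 1 1 ≤ 1 := by
  obtain ⟨n, w, κ, f, g, hw, hs, hp⟩ := h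
  simp only [hp]
  rw [← hs]
  simp only [← Finset.sum_neg_distrib, ← Finset.sum_add_distrib, ← Finset.sum_sub_distrib]
  refine Finset.sum_le_sum fun k _ => ?_
  have := mul_le_mul_of_nonneg_left (det_bound (κ k) (f k) (g k)) (hw k)
  linarith
end

section
/- Every correlation p achievable by local shared randomness plus one bit of communication from Alice to Bob (with M_A = 3, M_B = 2 measurement settings and binary outcomes) satisfies Bell inequality VII: −3·q_A(0|0) + 2·p(00|00) − 2·p(00|10) + 2·p(00|01) + p(00|11) − p(00|21) − p(10|00) − 2·p(10|10) + p(10|20) − p(10|01) + p(10|11) − 2·p(10|21) ≤ 1. -/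
/-- Integer version of `detCorr`, in terms of the relevant outputs. -/
def indI (a b x y : Fin 2) : ℤ := if a = x ∧ b = y then 1 else 0

/-- The inequality for deterministic strategies, over the integers; `G` is Bob's answer table. -/
theorem det_int : ∀ k0 k1 k2 f0 f1 f2 g00 g01 g10 g11 : Fin 2,
    let y0 : Fin 2 → Fin 2 := fun k => if k = 0 then g00 else g01
    let y1 : Fin 2 → Fin 2 := fun k => if k = 0 then g10 else g11;
    -3 * (indI 0 0 f0 (y0 k0) + indI 0 1 f0 (y0 k0)) + 2 * indI 0 0 f0 (y0 k0)
      - 2 * indI 0 0 f1 (y0 k1) + 2 * indI 0 0 f0 (y1 k0) + indI 0 0 f1 (y1 k1)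
      - indI 0 0 f2 (y1 k2) - indI 1 0 f0 (y0 k0) - 2 * indI 1 0 f1 (y0 k1)
      + indI 1 0 f2 (y0 k2) - indI 1 0 f0 (y1 k0) + indI 1 0 f1 (y1 k1)
      - 2 * indI 1 0 f2 (y1 k2) ≤ 1 := by
  decide +kernel

theorem detCorr_eq (κ f : Fin 3 → Fin 2) (g : Fin 2 × Fin 2 → Fin 2) (a b : Fin 2) (i : Fin 3)
    (j : Fin 2) : detCorr κ f g a b i j = (indI a b (f i) (g (j, κ i)) : ℝ) := by
  unfold detCorr indI
  split_ifs <;> simp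

theorem det_real (κ f : Fin 3 → Fin 2) (g : Fin 2 × Fin 2 → Fin 2) :
    -3 * (detCorr κ f g 0 0 0 0 + detCorr κ f g 0 1 0 0) + 2 * detCorr κ f g 0 0 0 0
      - 2 * detCorr κ f g 0 0 1 0 + 2 * detCorr κ f g 0 0 0 1 + detCorr κ f g 0 0 1 1
      - detCorr κ f g 0 0 2 1 - detCorr κ f g 1 0 0 0 - 2 * detCorr κ f g 1 0 1 0
      + detCorr κ f g 1 0 2 0 - detCorr κ f g 1 0 0 1 + detCorr κ f g 1 0 1 1
      - 2 * detCorr κ f g 1 0 2 1 ≤ 1 := by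
  have hg : ∀ j k : Fin 2, g (j, k) = if k = 0 then g (j, 0) else g (j, 1) := by
    intro j k
    fin_cases k <;> simp
  have h := det_int (κ 0) (κ 1) (κ 2) (f 0) (f 1) (f 2) (g (0, 0)) (g (0, 1)) (g (1, 0)) (g (1, 1))
  simp only [← hg] at h
  simp only [detCorr_eq]
  exact_mod_cast h

/-- Bell inequality VII for LSR plus one bit of Alice→Bob communication. -/
theorem bell_VII (p : Fin 2 → Fin 2 → Fin 3 → Fin 2 → ℝ) (h : AchievableAtoB p) :
    -3 * qA0 p 0 + 2 * p 0 0 0 0 - 2 * p 0 0 1 0 + 2 * p 0 0 0 1 + p 0 0 1 1 - p 0 0 2 1 - p 1 0 0 0 - 2 * p 1 0 1 0 + p 1 0 2 0 - p 1 0 0 1 + p 1 0 1 1 - 2 * p 1 0 2 1 ≤ 1 := by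
  obtain ⟨n, w, κ, f, g, hw, hs, hp⟩ := h
  have key := Finset.sum_le_sum (s := Finset.univ) fun k _ =>
    mul_le_mul_of_nonneg_left (det_real (κ k) (f k) (g k)) (hw k)
  simp only [mul_one, hs] at key
  refine le_trans (le_of_eq ?_) key
  simp only [qA0, hp, ← Finset.sum_add_distrib, ← Finset.sum_sub_distrib, Finset.mul_sum]
  refine Finset.sum_congr rfl fun k _ => ?_
  ring
end

section
/- Let M_A = 3 and M_B = 2 with binary outcomes, let f : Fin 2 → Fin 2 be a non-constant function and g : Fin 3 → Fin 2 a non-constant function, and define the correlation p(ab|ij) = 1 if a = f(j) and b = g(i), and 0 otherwise (each party's output is a non-constant function of the OTHER party's input). Then p is NOT achievable by local shared randomness plus one bit of bi-directional classical communication. -/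
/-- For 3×2 settings with binary outcomes, if Alice's output is a non-constant
function `f` of Bob's input and Bob's output is a non-constant function `g` of
Alice's input, the resulting correlation cannot be achieved by local shared
randomness plus one bit of bi-directional classical communication. -/
theorem cross_dependence_not_achievable (f : Fin 2 → Fin 2) (g : Fin 3 → Fin 2)
    (hf : ∃ j j' : Fin 2, f j ≠ f j') (hg : ∃ i i' : Fin 3, g i ≠ g i') :
    ¬ AchievableBi 3 2 1
      (fun a b i j => if a = f j ∧ b = g i then (1 : ℝ) else 0) := by
  rintro ⟨n, w, S, hw, hsum, hp⟩
  obtain ⟨j, j', hj⟩ := hf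
  obtain ⟨i, i', hi⟩ := hg
  have hk : ∃ k, w k ≠ 0 := by
    by_contra! h
    simp [h] at hsum
  obtain ⟨k, hk⟩ := hk
  -- every strategy with nonzero weight reproduces the correlation exactly
  have key : ∀ i j, f j = (S k).f (i, (S k).sigma j) ∧ g i = (S k).g (j, (S k).kappa i) := by
    intro i j
    by_contra hne
    have h1 := hp (f j) (g i) i j
    simp only [and_self, if_true] at h1
    have hlt : ∑ l, w l * (S l).corr (f j) (g i) i j < ∑ l, w l := by
      apply Finset.sum_lt_sum
      · intro l _
        apply mul_le_of_le_one_right (hw l)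
        unfold BiStrategy.corr
        split_ifs <;> norm_num
      · refine ⟨k, Finset.mem_univ k, ?_⟩
        have h0 : (S k).corr (f j) (g i) i j = 0 := by
          unfold BiStrategy.corr
          exact if_neg hne
        rw [h0, mul_zero]
        exact lt_of_le_of_ne (hw k) (Ne.symm hk)
    linarith
  generalize S k = T at key
  obtain ⟨s, hs, kappa, sigma, F, G⟩ := T
  dsimp only at key
  interval_cases s
  · apply hi
    have h : kappa i = kappa i' := Subsingleton.elim (α := Fin 1) _ _
    rw [(key i j).2, (key i' j).2, h]
  · apply hj
    have h : sigma j = sigma j' := Subsingleton.elim (α := Fin 1) _ _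
    rw [(key i j).1, (key i j').1, h]
end

section
/- For any natural numbers M_A, M_B ≥ 2 and any r with 2^r < min{M_A, M_B}, there exists a no-signaling correlation with M_A×M_B measurement settings and binary outcomes that is not achievable by local shared randomness plus r bits of bi-directional classical communication; hence at least min{⌈log₂ M_A⌉, ⌈log₂ M_B⌉} bits of classical communication are required to produce all no-signaling correlations. -/
/-- The target XOR function: the partial identity with row and column `0` erased. -/
def targetXor (i j : ℕ) : ZMod 2 := if i = j ∧ i ≠ 0 then 1 else 0

/-- A rank argument: the target function on a square of side `n > A * B` is not the sum of a
function factoring through `A` column classes and one factoring through `B` row classes. -/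
lemma no_decomposition (n A B : ℕ) (hn : A * B < n)
    (κ : Fin n → Fin B) (σ : Fin n → Fin A)
    (f : Fin n → Fin A → ZMod 2) (g : Fin n → Fin B → ZMod 2)
    (h : ∀ i j, f i (σ j) + g j (κ i) = targetXor i.val j.val) : False := by
  have hn0 : 0 < n := by omega
  let z : Fin n := ⟨0, hn0⟩
  have hA : 0 < A := (σ z).pos
  have hB : 0 < B := (κ z).pos
  let L : (Fin n → ZMod 2) →ₗ[ZMod 2] (Fin A → ZMod 2) × ({k : Fin B // k ≠ κ z} → ZMod 2) :=
    { toFun := fun x => (fun k => ∑ j, if σ j = k then x j else 0,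
        fun k => ∑ j, g j k.1 * x j)
      map_add' := by
        intro x y
        ext k
        · simp only [Pi.add_apply, Prod.mk_add_mk, ← Finset.sum_add_distrib]
          refine Finset.sum_congr rfl fun j _ => ?_
          split_ifs <;> simp
        · simp [mul_add, Finset.sum_add_distrib]
      map_smul' := by
        intro c x
        ext k
        · simp [Finset.mul_sum]
        · simp only [Pi.smul_apply, smul_eq_mul, RingHom.id_apply, Prod.smul_mk, Finset.mul_sum]
          refine Finset.sum_congr rfl fun j _ => ?_
          ring }
  have hlt : Module.finrank (ZMod 2) ((Fin A → ZMod 2) × ({k : Fin B // k ≠ κ z} → ZMod 2))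
      < Module.finrank (ZMod 2) (Fin n → ZMod 2) := by
    have hc : Fintype.card {k : Fin B // k ≠ κ z} = B - 1 := by
      simp [Fintype.card_subtype_compl]
    rw [Module.finrank_prod, Module.finrank_fintype_fun_eq_card,
      Module.finrank_fintype_fun_eq_card, Module.finrank_fintype_fun_eq_card, hc]
    simp only [Fintype.card_fin]
    obtain ⟨a, rfl⟩ : ∃ a, A = a + 1 := ⟨A - 1, by omega⟩
    obtain ⟨b, rfl⟩ : ∃ b, B = b + 1 := ⟨B - 1, by omega⟩
    simp only [Nat.add_sub_cancel]
    nlinarith [Nat.zero_le (a * b)]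
  obtain ⟨x, hx, hx0⟩ := Submodule.exists_mem_ne_zero_of_ne_bot
    (LinearMap.ker_ne_bot_of_finrank_lt (f := L) hlt)
  have hLx : L x = 0 := hx
  have h1 : ∀ k, (∑ j, if σ j = k then x j else 0) = 0 := fun k =>
    congrFun (congrArg Prod.fst hLx) k
  have h2 : ∀ k, k ≠ κ z → ∑ j, g j k * x j = 0 := fun k hk =>
    congrFun (congrArg Prod.snd hLx) ⟨k, hk⟩
  have hf : ∀ i, ∑ j, f i (σ j) * x j = 0 := by
    intro i
    have : ∀ j, f i (σ j) * x j = ∑ k, f i k * (if σ j = k then x j else 0) := by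
      intro j; simp
    simp_rw [this]
    rw [Finset.sum_comm]
    simp_rw [← Finset.mul_sum, h1]
    simp
  have hsum : ∀ i : Fin n, ∑ j : Fin n, targetXor i.val j.val * x j = ∑ j, g j (κ i) * x j := by
    intro i
    simp_rw [← h, add_mul, Finset.sum_add_distrib, hf, zero_add]
  have hg : ∀ k, ∑ j, g j k * x j = 0 := by
    intro k
    by_cases hk : k = κ z
    · rw [hk, ← hsum]
      simp [targetXor, z]
    · exact h2 k hk
  have hxi : ∀ i, i ≠ z → x i = 0 := by
    intro i hi
    have hi0 : i.val ≠ 0 := fun e => hi (Fin.ext e)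
    have := hsum i
    rw [hg] at this
    simpa [targetXor, hi0, Fin.val_inj] using this
  have hxz : x z = 0 := by
    have := h1 (σ z)
    rw [Finset.sum_eq_single z] at this
    · simpa using this
    · intro j _ hj
      simp [hxi j hj]
    · simp
  apply hx0
  ext i
  by_cases hi : i = z
  · rw [hi, hxz]; rfl
  · rw [hxi i hi]; rfl

/-- For `M_A, M_B ≥ 2` and `2^r < min{M_A, M_B}`, there exists a valid
no-signaling correlation with binary outcomes that is not achievable by local
shared randomness plus `r` bits of bi-directional classical communication;
hence at least `min{⌈log₂ M_A⌉, ⌈log₂ M_B⌉}` bits of classical communication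
are required to produce all no-signaling correlations. -/
theorem exists_noSignaling_not_achievable (MA MB r : ℕ) (hA : 2 ≤ MA) (hB : 2 ≤ MB)
    (hr : 2 ^ r < min MA MB) :
    ∃ p : Fin 2 → Fin 2 → Fin MA → Fin MB → ℝ,
      (∀ a b i j, 0 ≤ p a b i j) ∧
      (∀ i j, ∑ a : Fin 2, ∑ b : Fin 2, p a b i j = 1) ∧
      (∀ (a : Fin 2) (i : Fin MA) (j j' : Fin MB),
        ∑ b : Fin 2, p a b i j = ∑ b : Fin 2, p a b i j') ∧
      (∀ (b : Fin 2) (j : Fin MB) (i i' : Fin MA),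
        ∑ a : Fin 2, p a b i j = ∑ a : Fin 2, p a b i' j) ∧
      ¬ AchievableBi MA MB r p := by
  let t : ℕ → ℕ → Fin 2 := fun i j => targetXor i j
  let p : Fin 2 → Fin 2 → Fin MA → Fin MB → ℝ := fun a b i j =>
    if a + b = t i.val j.val then 1 / 2 else 0
  have hb : ∀ (a c : Fin 2), ∑ b : Fin 2, (if a + b = c then (1 / 2 : ℝ) else 0) = 1 / 2 := by
    intro a c
    fin_cases a <;> fin_cases c <;> simp
  have ha : ∀ (b c : Fin 2), ∑ a : Fin 2, (if a + b = c then (1 / 2 : ℝ) else 0) = 1 / 2 := by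
    intro b c
    simp_rw [add_comm _ b]
    exact hb b c
  have hpb : ∀ a i j, ∑ b : Fin 2, p a b i j = 1 / 2 := fun a i j => hb a (t i.val j.val)
  have hpa : ∀ b i j, ∑ a : Fin 2, p a b i j = 1 / 2 := fun b i j => ha b (t i.val j.val)
  refine ⟨p, ?_, ?_, ?_, ?_, ?_⟩
  · intro a b i j
    simp only [p]
    split_ifs <;> norm_num
  · intro i j
    simp only [hpb]
    norm_num
  · intro a i j j'
    simp only [hpb]
  · intro b j i i'
    simp only [hpa]
  · rintro ⟨n, w, S, hw, hw1, hp⟩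
    obtain ⟨k, hk⟩ : ∃ k, 0 < w k := by
      by_contra! hcon
      have := Finset.sum_nonpos (s := Finset.univ) fun k _ => hcon k
      linarith
    have key : ∀ i j, (S k).f (i, (S k).sigma j) + (S k).g (j, (S k).kappa i)
        = t i.val j.val := by
      intro i j
      by_contra hne
      have h0 := hp ((S k).f (i, (S k).sigma j)) ((S k).g (j, (S k).kappa i)) i j
      simp only [p, if_neg hne] at h0
      have hle := Finset.single_le_sum (s := Finset.univ)
        (f := fun l => w l * (S l).corr ((S k).f (i, (S k).sigma j))
          ((S k).g (j, (S k).kappa i)) i j)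
        (fun l _ => mul_nonneg (hw l) (by unfold BiStrategy.corr; split_ifs <;> norm_num))
        (Finset.mem_univ k)
      rw [← h0] at hle
      simp [BiStrategy.corr] at hle
      linarith
    have hmin : 2 ^ (r - (S k).s) * 2 ^ (S k).s < min MA MB := by
      rw [← pow_add, Nat.sub_add_cancel (S k).hs]
      exact hr
    exact no_decomposition (min MA MB) _ _ hmin
      (fun i => (S k).kappa (Fin.castLE (min_le_left _ _) i))
      (fun j => (S k).sigma (Fin.castLE (min_le_right _ _) j))
      (fun i c => (S k).f (Fin.castLE (min_le_left _ _) i, c))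
      (fun j c => (S k).g (Fin.castLE (min_le_right _ _) j, c))
      (fun i j => key (Fin.castLE (min_le_left _ _) i) (Fin.castLE (min_le_right _ _) j))
end
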